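/- Let U ⊆ ℝ² be open and a, b : U → ℝ smooth functions satisfying the Cauchy–Riemann equations ∂₁a = ∂₂b and ∂₂a = −∂₁b. Let g : U → GL_m(ℂ) and φ : U → M_m(ℂ) be twice continuously differentiable and suppose they are related by the Miura-type transformation ∂₁φ = ( a·∂₁g + b·∂₂g ) g^{-1} and ∂₂φ = ( a·∂₂g − b·∂₁g ) g^{-1} on U. Then φ satisfies b·(∂₁∂₁φ + ∂₂∂₂φ) = [ ∂₁φ , ∂₂φ ] and g satisfies b·( ∂₁((∂₁g) g^{-1}) + ∂₂((∂₂g) g^{-1}) ) = a·[ (∂₁g) g^{-1} , (∂₂g) g^{-1} ] on U. -/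

import Mathlib

open scoped BigOperators

/-- Partial derivative of a real-valued function on `ℝⁿ` in the `μ`-th coordinate direction. -/
noncomputable def pd {n : ℕ} (μ : Fin n) (f : (Fin n → ℝ) → ℝ) (x : Fin n → ℝ) : ℝ :=
  fderiv ℝ f x (Pi.single μ 1)

/-- Entrywise partial derivative of a matrix-valued function on `ℝⁿ`. -/
noncomputable def pdM {n m r : ℕ} (μ : Fin n) (f : (Fin n → ℝ) → Matrix (Fin m) (Fin r) ℂ)
    (x : Fin n → ℝ) : Matrix (Fin m) (Fin r) ℂ :=
  Matrix.of fun i j => fderiv ℝ (fun y => f y i j) x (Pi.single μ 1)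

/-- Entrywise differentiability of a matrix-valued function on `ℝⁿ`. -/
def EntrywiseDifferentiableAt {n m r : ℕ} (f : (Fin n → ℝ) → Matrix (Fin m) (Fin r) ℂ)
    (x : Fin n → ℝ) : Prop :=
  ∀ i j, DifferentiableAt ℝ (fun y => f y i j) x

namespace EntrywiseDifferentiableAt

variable {n m r s : ℕ} {x : Fin n → ℝ}

theorem add {f g : (Fin n → ℝ) → Matrix (Fin m) (Fin r) ℂ} (hf : EntrywiseDifferentiableAt f x)
    (hg : EntrywiseDifferentiableAt g x) : EntrywiseDifferentiableAt (fun y => f y + g y) x :=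
  fun i j => (hf i j).add (hg i j)

theorem smul {a : (Fin n → ℝ) → ℝ} {f : (Fin n → ℝ) → Matrix (Fin m) (Fin r) ℂ}
    (ha : DifferentiableAt ℝ a x) (hf : EntrywiseDifferentiableAt f x) :
    EntrywiseDifferentiableAt (fun y => a y • f y) x :=
  fun i j => ha.smul (hf i j)

theorem mul {f : (Fin n → ℝ) → Matrix (Fin m) (Fin r) ℂ}
    {g : (Fin n → ℝ) → Matrix (Fin r) (Fin s) ℂ} (hf : EntrywiseDifferentiableAt f x)
    (hg : EntrywiseDifferentiableAt g x) : EntrywiseDifferentiableAt (fun y => f y * g y) x := by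
  intro i j
  simp only [Matrix.mul_apply]
  exact DifferentiableAt.fun_sum fun k _ => (hf i k).mul (hg k j)

theorem det {f : (Fin n → ℝ) → Matrix (Fin m) (Fin m) ℂ} (hf : EntrywiseDifferentiableAt f x) :
    DifferentiableAt ℝ (fun y => (f y).det) x := by
  simp only [Matrix.det_apply']
  refine DifferentiableAt.fun_sum fun σ _ => (differentiableAt_const _).mul ?_
  exact (HasFDerivAt.finsetProd fun i _ => (hf (σ i) i).hasFDerivAt).differentiableAt

theorem inv {f : (Fin n → ℝ) → Matrix (Fin m) (Fin m) ℂ} (hf : EntrywiseDifferentiableAt f x)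
    (hx : IsUnit (f x)) : EntrywiseDifferentiableAt (fun y => (f y)⁻¹) x := by
  intro i j
  have hdet : (f x).det ≠ 0 := ((Matrix.isUnit_iff_isUnit_det _).mp hx).ne_zero
  simp only [Matrix.inv_def, Matrix.smul_apply, Matrix.adjugate_apply, Ring.inverse_eq_inv',
    smul_eq_mul]
  refine (hf.det.inv hdet).mul (det fun k l => ?_)
  by_cases hk : k = j
  · subst hk
    simp
  · simpa [Matrix.updateRow_ne hk] using hf k l

end EntrywiseDifferentiableAt

section pdM

variable {n m r s : ℕ} {x : Fin n → ℝ} (μ : Fin n)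

theorem pdM_congr {f g : (Fin n → ℝ) → Matrix (Fin m) (Fin r) ℂ} (h : f =ᶠ[nhds x] g) :
    pdM μ f x = pdM μ g x := by
  ext i j
  have hij : (fun y => f y i j) =ᶠ[nhds x] fun y => g y i j := h.mono fun y hy => by simp only [hy]
  simp only [pdM, Matrix.of_apply, hij.fderiv_eq]

theorem pdM_add {f g : (Fin n → ℝ) → Matrix (Fin m) (Fin r) ℂ}
    (hf : EntrywiseDifferentiableAt f x) (hg : EntrywiseDifferentiableAt g x) :
    pdM μ (fun y => f y + g y) x = pdM μ f x + pdM μ g x := by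
  ext i j
  simp [pdM, fderiv_fun_add (hf i j) (hg i j)]

theorem pdM_sub {f g : (Fin n → ℝ) → Matrix (Fin m) (Fin r) ℂ}
    (hf : EntrywiseDifferentiableAt f x) (hg : EntrywiseDifferentiableAt g x) :
    pdM μ (fun y => f y - g y) x = pdM μ f x - pdM μ g x := by
  ext i j
  simp [pdM, fderiv_fun_sub (hf i j) (hg i j)]

theorem pdM_smul {a : (Fin n → ℝ) → ℝ} {f : (Fin n → ℝ) → Matrix (Fin m) (Fin r) ℂ}
    (ha : DifferentiableAt ℝ a x) (hf : EntrywiseDifferentiableAt f x) :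
    pdM μ (fun y => a y • f y) x = pd μ a x • f x + a x • pdM μ f x := by
  ext i j
  have h := congrArg (fun L => L (Pi.single μ 1)) (fderiv_fun_smul ha (hf i j))
  simpa [pdM, pd, add_comm] using h

theorem pdM_mul {f : (Fin n → ℝ) → Matrix (Fin m) (Fin r) ℂ}
    {g : (Fin n → ℝ) → Matrix (Fin r) (Fin s) ℂ}
    (hf : EntrywiseDifferentiableAt f x) (hg : EntrywiseDifferentiableAt g x) :
    pdM μ (fun y => f y * g y) x = pdM μ f x * g x + f x * pdM μ g x := by
  ext i j
  simp only [pdM, Matrix.of_apply, Matrix.add_apply, Matrix.mul_apply]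
  rw [fderiv_fun_sum fun k _ => (hf i k).fun_mul (hg k j), ← Finset.sum_add_distrib,
    sum_apply]
  refine Finset.sum_congr rfl fun k _ => ?_
  rw [fderiv_fun_mul (hf i k) (hg k j)]
  simp only [add_apply, smul_apply, smul_eq_mul]
  ring

theorem differentiableAt_fderiv_of_contDiffAt_two {f : (Fin n → ℝ) → ℂ}
    (hf : ContDiffAt ℝ 2 f x) : DifferentiableAt ℝ (fderiv ℝ f) x :=
  (hf.fderiv_right (m := 1) (by norm_num)).differentiableAt (by norm_num)

theorem entrywiseDifferentiableAt_pdM {f : (Fin n → ℝ) → Matrix (Fin m) (Fin r) ℂ}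
    (hf : ∀ i j, ContDiffAt ℝ 2 (fun y => f y i j) x) :
    EntrywiseDifferentiableAt (pdM μ f) x :=
  fun i j => (differentiableAt_fderiv_of_contDiffAt_two (hf i j)).clm_apply
    (differentiableAt_const _)

theorem pdM_pdM_apply {f : (Fin n → ℝ) → Matrix (Fin m) (Fin r) ℂ}
    (hf : ∀ i j, ContDiffAt ℝ 2 (fun y => f y i j) x) (ν : Fin n) (i : Fin m) (j : Fin r) :
    pdM μ (pdM ν f) x i j =
      fderiv ℝ (fderiv ℝ fun y => f y i j) x (Pi.single μ 1) (Pi.single ν 1) := by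
  simp only [pdM, Matrix.of_apply]
  rw [fderiv_clm_apply (differentiableAt_fderiv_of_contDiffAt_two (hf i j))
    (differentiableAt_const _)]
  simp

theorem pdM_comm {f : (Fin n → ℝ) → Matrix (Fin m) (Fin r) ℂ}
    (hf : ∀ i j, ContDiffAt ℝ 2 (fun y => f y i j) x) (ν : Fin n) :
    pdM μ (pdM ν f) x = pdM ν (pdM μ f) x := by
  ext i j
  rw [pdM_pdM_apply μ hf, pdM_pdM_apply ν hf]
  exact ((hf i j).isSymmSndFDerivAt (by simp)) _ _

/-- The derivative of a logarithmic derivative `(∂_ν g) g⁻¹`. -/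
theorem pdM_pdM_mul_inv {g : (Fin n → ℝ) → Matrix (Fin m) (Fin m) ℂ}
    (hg : ∀ i j, ContDiffAt ℝ 2 (fun y => g y i j) x) (hx : ∀ᶠ y in nhds x, IsUnit (g y))
    (ν : Fin n) :
    pdM μ (fun y => pdM ν g y * (g y)⁻¹) x =
      pdM μ (pdM ν g) x * (g x)⁻¹ - (pdM ν g x * (g x)⁻¹) * (pdM μ g x * (g x)⁻¹) := by
  have hgx : EntrywiseDifferentiableAt g x := fun i j => (hg i j).differentiableAt (by norm_num)
  have hdet := (Matrix.isUnit_iff_isUnit_det _).mp hx.self_of_nhds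
  have hA : EntrywiseDifferentiableAt (fun y => pdM ν g y * (g y)⁻¹) x :=
    (entrywiseDifferentiableAt_pdM ν hg).mul (hgx.inv hx.self_of_nhds)
  have hcongr : (fun y => pdM ν g y * (g y)⁻¹ * g y) =ᶠ[nhds x] pdM ν g :=
    hx.mono fun y hy =>
      Matrix.nonsing_inv_mul_cancel_right _ _ ((Matrix.isUnit_iff_isUnit_det _).mp hy)
  have hmul := pdM_mul μ hA hgx
  rw [pdM_congr μ hcongr] at hmul
  rw [hmul, add_mul, Matrix.mul_nonsing_inv_cancel_right _ _ hdet]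
  simp only [mul_assoc, add_sub_cancel_right]

end pdM

/-- the Miura-type transformation relating `g` and `φ` implies that `φ` solves
`b·Δφ = [∂₁φ, ∂₂φ]` and `g` solves the non-autonomous chiral model equation. -/
theorem statement5 {m : ℕ} (U : Set (Fin 2 → ℝ)) (hU : IsOpen U)
    (a b : (Fin 2 → ℝ) → ℝ)
    (ha : ContDiffOn ℝ (⊤ : ℕ∞) a U) (hb : ContDiffOn ℝ (⊤ : ℕ∞) b U)
    (hCR1 : ∀ x ∈ U, pd 0 a x = pd 1 b x) (hCR2 : ∀ x ∈ U, pd 1 a x = -(pd 0 b x))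
    (g φ : (Fin 2 → ℝ) → Matrix (Fin m) (Fin m) ℂ)
    (hg : ∀ i j, ContDiffOn ℝ 2 (fun y => g y i j) U)
    (hφ : ∀ i j, ContDiffOn ℝ 2 (fun y => φ y i j) U)
    (hginv : ∀ x ∈ U, IsUnit (g x))
    (hMiura1 : ∀ x ∈ U, pdM 0 φ x = (a x • pdM 0 g x + b x • pdM 1 g x) * (g x)⁻¹)
    (hMiura2 : ∀ x ∈ U, pdM 1 φ x = (a x • pdM 1 g x - b x • pdM 0 g x) * (g x)⁻¹) :
    (∀ x ∈ U, b x • (pdM 0 (pdM 0 φ) x + pdM 1 (pdM 1 φ) x)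
        = pdM 0 φ x * pdM 1 φ x - pdM 1 φ x * pdM 0 φ x) ∧
    (∀ x ∈ U, b x • (pdM 0 (fun y => pdM 0 g y * (g y)⁻¹) x
          + pdM 1 (fun y => pdM 1 g y * (g y)⁻¹) x)
        = a x • ((pdM 0 g x * (g x)⁻¹) * (pdM 1 g x * (g x)⁻¹)
                - (pdM 1 g x * (g x)⁻¹) * (pdM 0 g x * (g x)⁻¹))) := by
  have key : ∀ x ∈ U,
      (b x • (pdM 0 (pdM 0 φ) x + pdM 1 (pdM 1 φ) x)
        = pdM 0 φ x * pdM 1 φ x - pdM 1 φ x * pdM 0 φ x) ∧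
      (b x • (pdM 0 (fun y => pdM 0 g y * (g y)⁻¹) x
          + pdM 1 (fun y => pdM 1 g y * (g y)⁻¹) x)
        = a x • ((pdM 0 g x * (g x)⁻¹) * (pdM 1 g x * (g x)⁻¹)
                - (pdM 1 g x * (g x)⁻¹) * (pdM 0 g x * (g x)⁻¹))) := by
    intro x hx
    have hxU : U ∈ nhds x := hU.mem_nhds hx
    have hgx : ∀ i j, ContDiffAt ℝ 2 (fun y => g y i j) x := fun i j => (hg i j).contDiffAt hxU
    have hφx : ∀ i j, ContDiffAt ℝ 2 (fun y => φ y i j) x := fun i j => (hφ i j).contDiffAt hxU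
    have hax : DifferentiableAt ℝ a x := (ha.contDiffAt hxU).differentiableAt (by simp)
    have hbx : DifferentiableAt ℝ b x := (hb.contDiffAt hxU).differentiableAt (by simp)
    have hunit : ∀ᶠ y in nhds x, IsUnit (g y) := Filter.mem_of_superset hxU hginv
    have hdiff : ∀ ν, EntrywiseDifferentiableAt (fun y => pdM ν g y * (g y)⁻¹) x := fun ν =>
      (entrywiseDifferentiableAt_pdM ν hgx).mul
        (EntrywiseDifferentiableAt.inv (fun i j => (hgx i j).differentiableAt (by norm_num))
          (hginv x hx))
    have hφ0 : pdM 0 φ =ᶠ[nhds x]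
        fun y => a y • (pdM 0 g y * (g y)⁻¹) + b y • (pdM 1 g y * (g y)⁻¹) := by
      filter_upwards [hxU] with y hy
      rw [hMiura1 y hy, add_mul, Matrix.smul_mul, Matrix.smul_mul]
    have hφ1 : pdM 1 φ =ᶠ[nhds x]
        fun y => a y • (pdM 1 g y * (g y)⁻¹) - b y • (pdM 0 g y * (g y)⁻¹) := by
      filter_upwards [hxU] with y hy
      rw [hMiura2 y hy, sub_mul, Matrix.smul_mul, Matrix.smul_mul]
    have hd0 : ∀ μ, pdM μ (pdM 0 φ) x = _ := fun μ => (pdM_congr μ hφ0).trans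
      (pdM_add μ (.smul hax (hdiff 0)) (.smul hbx (hdiff 1)))
    have hd1 : ∀ μ, pdM μ (pdM 1 φ) x = _ := fun μ => (pdM_congr μ hφ1).trans
      (pdM_sub μ (.smul hax (hdiff 1)) (.smul hbx (hdiff 0)))
    simp only [pdM_smul _ hax (hdiff _), pdM_smul _ hbx (hdiff _)] at hd0 hd1
    have hcompat := pdM_comm 1 hφx 0
    have hcurv : pdM 1 (fun y => pdM 0 g y * (g y)⁻¹) x - pdM 0 (fun y => pdM 1 g y * (g y)⁻¹) x
        = (pdM 1 g x * (g x)⁻¹) * (pdM 0 g x * (g x)⁻¹)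
          - (pdM 0 g x * (g x)⁻¹) * (pdM 1 g x * (g x)⁻¹) := by
      rw [pdM_pdM_mul_inv 1 hgx hunit, pdM_pdM_mul_inv 0 hgx hunit, pdM_comm 1 hgx 0]
      abel
    rw [hd0, hd1, hCR1 x hx, hCR2 x hx] at hcompat
    rw [hd0, hd1, hCR1 x hx, hCR2 x hx, hφ0.self_of_nhds, hφ1.self_of_nhds]
    beta_reduce
    generalize pdM 1 (fun y => pdM 0 g y * (g y)⁻¹) x = A₁ at *
    generalize pdM 0 (fun y => pdM 0 g y * (g y)⁻¹) x = A₀ at *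
    generalize pdM 1 (fun y => pdM 1 g y * (g y)⁻¹) x = B₁ at *
    generalize pdM 0 (fun y => pdM 1 g y * (g y)⁻¹) x = B₀ at *
    generalize pdM 0 g x * (g x)⁻¹ = A at *
    generalize pdM 1 g x * (g x)⁻¹ = B at *
    have hchiral : b x • (A₀ + B₁) = a x • (A * B - B * A) := by
      rw [← neg_sub (B * A), ← hcurv]
      linear_combination (norm := module) hcompat
    refine ⟨?_, hchiral⟩
    simp only [Matrix.add_mul, Matrix.mul_add, Matrix.sub_mul, Matrix.mul_sub, Matrix.smul_mul,
      Matrix.mul_smul]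
    linear_combination (norm := module) a x • hchiral - (b x * b x) • hcurv
  exact ⟨fun x hx => (key x hx).1, fun x hx => (key x hx).2⟩
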